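/- arXiv:1011.1102 — 2 statements merged into one kernel-verified Lean document; each statement's English description precedes it below -/
import Mathlib

section
/- Let a < 0 < b be reals with −a ≤ b/3. Then almost surely the walk driven by D^{a,b} does not eventually remain in any finite set: the event that there exist n₀ ≥ 0 and a finite set S ⊂ ℤ with X_n ∈ S for all n ≥ n₀ has probability zero. -/
open MeasureTheory Real Filter Set

noncomputable section

/-- Number of crossings of the edge `{e, e+1}` (i.e. the half-integer edge `e + 1/2`)
before time `n`. -/
def locTime {Ω : Type*} (X : ℕ → Ω → ℤ) (n : ℕ) (e : ℤ) (ω : Ω) : ℕ :=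
  ((Finset.range n).filter fun m => min (X m ω) (X (m + 1) ω) = e).card

/-- Local time profile seen from the walker: `ℓ_n(k + 1/2)`. -/
def shiftedProfile {Ω : Type*} (X : ℕ → Ω → ℤ) (n : ℕ) (k : ℤ) (ω : Ω) : ℕ :=
  locTime X n (X n ω + k) ω

/-- `F(y) = e^y / (e^y + e^{-y})`. -/
def walkF (y : ℝ) : ℝ := Real.exp y / (Real.exp y + Real.exp (-y))

/-- The σ-algebra generated by `X_0, …, X_n`. -/
def walkFiltration {Ω : Type*} (X : ℕ → Ω → ℤ) (n : ℕ) : MeasurableSpace Ω :=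
  ⨆ m ∈ Finset.range (n + 1), MeasurableSpace.comap (X m) inferInstance

/-- The drift `D^{a,b}(ℓ_n) = a ℓ_n(-3/2) + b ℓ_n(-1/2) - b ℓ_n(1/2) - a ℓ_n(3/2)`,
with the half-integer edge `k + 1/2` encoded by the integer `k`. -/
def Dab {Ω : Type*} (a b : ℝ) (X : ℕ → Ω → ℤ) (n : ℕ) (ω : Ω) : ℝ :=
  a * shiftedProfile X n (-2) ω + b * shiftedProfile X n (-1) ω
    - b * shiftedProfile X n 0 ω - a * shiftedProfile X n 1 ω

/-- The drift at the site `x` determined by the edge profile `ℓ`. -/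
def profileDrift (a b : ℝ) (ℓ : ℤ → ℝ) (x : ℤ) : ℝ :=
  a * ℓ (x - 2) + b * ℓ (x - 1) - b * ℓ x - a * ℓ (x + 1)

/-- The energy of the edge profile `ℓ`, restricted to the box `[-N, N]`. -/
def profileEnergy (a b : ℝ) (N : ℕ) (ℓ : ℤ → ℝ) : ℝ :=
  (1 / 2) * ∑ x ∈ Finset.Icc (-(N : ℤ)) N,
    (-a * (ℓ (x + 1) - 2 * ℓ x + ℓ (x - 1)) ^ 2 + (b + 3 * a) * (ℓ x - ℓ (x - 1)) ^ 2)

/-- Crossing the edge `e` once changes the energy by a difference of drifts. -/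
lemma profileEnergy_add_single (a b : ℝ) (N : ℕ) (ℓ : ℤ → ℝ) (e : ℤ) (h₁ : -(N : ℤ) < e)
    (h₂ : e < N) :
    profileEnergy a b N (fun x => ℓ x + if e = x then 1 else 0) =
      profileEnergy a b N ℓ + (profileDrift a b ℓ (e + 1) - profileDrift a b ℓ e + b) := by
  unfold profileEnergy
  rw [← sub_eq_iff_eq_add', ← mul_sub, ← Finset.sum_sub_distrib]
  have hsub : ({e - 1, e, e + 1} : Finset ℤ) ⊆ Finset.Icc (-(N : ℤ)) N := by
    intro x hx
    simp only [Finset.mem_insert, Finset.mem_singleton] at hx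
    rw [Finset.mem_Icc]
    omega
  rw [← Finset.sum_subset hsub]
  · rw [Finset.sum_insert (by simp; omega), Finset.sum_insert (by simp), Finset.sum_singleton]
    have h3 : e - 1 - 1 = e - 2 := by ring
    have h4 : e + 1 + 1 = e + 2 := by ring
    have h5 : e + 1 - 2 = e - 1 := by ring
    have n1 : e ≠ e - 1 := by omega
    have n2 : e ≠ e - 2 := by omega
    simp [profileDrift, h3, h4, h5, n1, n2]
    ring
  · intro x _ hx
    simp only [Finset.mem_insert, Finset.mem_singleton, not_or] at hx
    have n1 : e ≠ x + 1 := by omega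
    have n2 : e ≠ x := by omega
    have n3 : e ≠ x - 1 := by omega
    simp only [if_neg n1, if_neg n2, if_neg n3]
    ring

lemma profileEnergy_nonneg {a b : ℝ} (ha : a ≤ 0) (hab : -a ≤ b / 3) (N : ℕ) (ℓ : ℤ → ℝ) :
    0 ≤ profileEnergy a b N ℓ := by
  have h1 : 0 ≤ -a := by linarith
  have h2 : 0 ≤ b + 3 * a := by linarith
  unfold profileEnergy
  positivity

lemma sq_second_diff_le_profileEnergy {a b : ℝ} (ha : a ≤ 0) (hab : -a ≤ b / 3) (N : ℕ)
    (ℓ : ℤ → ℝ) {x : ℤ} (hx : x ∈ Finset.Icc (-(N : ℤ)) N) :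
    -a * (ℓ (x + 1) - 2 * ℓ x + ℓ (x - 1)) ^ 2 ≤ 2 * profileEnergy a b N ℓ := by
  have h1 : 0 ≤ -a := by linarith
  have h2 : 0 ≤ b + 3 * a := by linarith
  have h := Finset.single_le_sum (f := fun x => -a * (ℓ (x + 1) - 2 * ℓ x + ℓ (x - 1)) ^ 2 +
    (b + 3 * a) * (ℓ x - ℓ (x - 1)) ^ 2) (fun i _ => by positivity) hx
  have h3 : 0 ≤ (b + 3 * a) * (ℓ x - ℓ (x - 1)) ^ 2 := by positivity
  unfold profileEnergy
  linarith

/-- A profile vanishing to the left of `c` is controlled by its second differences. -/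
lemma le_of_second_diff_le {ℓ : ℤ → ℝ} {c : ℤ} {t : ℝ} {K : ℕ} (ht : 0 ≤ t)
    (h0 : ℓ (c - 1) = 0) (h1 : ℓ c = 0)
    (h : ∀ k : ℕ, k < K → ℓ (c + k + 1) - 2 * ℓ (c + k) + ℓ (c + k - 1) ≤ t) :
    ∀ k : ℕ, k ≤ K → ℓ (c + k) ≤ (K : ℝ) ^ 2 * t := by
  have key : ∀ k : ℕ, k ≤ K → ℓ (c + k) - ℓ (c + k - 1) ≤ k * t ∧ ℓ (c + k) ≤ k * (K * t) := by
    intro k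
    induction k with
    | zero => intro _; simp [h0, h1]
    | succ k ih =>
      intro hk
      obtain ⟨i1, i2⟩ := ih (by omega)
      have h2 := h k (by omega)
      have hkK : ((k : ℝ) + 1) * t ≤ K * t := by
        gcongr
        exact_mod_cast hk
      have e1 : c + ((k + 1 : ℕ) : ℤ) = c + k + 1 := by push_cast; ring
      have e2 : c + (k : ℤ) + 1 - 1 = c + k := by ring
      rw [e1, e2]
      push_cast
      constructor <;> linarith
  intro k hk
  refine (key k hk).2.trans ?_
  have : (k : ℝ) ≤ K := by exact_mod_cast hk
  calc (k : ℝ) * (K * t) ≤ K * (K * t) := by gcongr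
    _ = _ := by ring

lemma mul_sub_mul_walkF_le (y s : ℝ) (hs : |s| ≤ 1) : s * y - y * (2 * walkF y - 1) ≤ 1 := by
  have hsy : s * y ≤ |y| := by
    calc s * y ≤ |s * y| := le_abs_self _
      _ = |s| * |y| := abs_mul _ _
      _ ≤ 1 * |y| := by gcongr
      _ = |y| := one_mul _
  suffices h : |y| - y * (2 * walkF y - 1) ≤ 1 by linarith
  have hp := Real.exp_pos y
  have hn := Real.exp_pos (-y)
  have hF : 2 * walkF y - 1 = (Real.exp y - Real.exp (-y)) / (Real.exp y + Real.exp (-y)) := by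
    unfold walkF
    field_simp
    ring
  have hmul : Real.exp y * Real.exp (-y) = 1 := by rw [← Real.exp_add]; simp
  rw [hF, sub_le_iff_le_add, ← sub_le_iff_le_add', ← mul_div_assoc, le_div_iff₀ (by positivity)]
  have h1 := Real.add_one_le_exp (2 * y)
  have h2 := Real.add_one_le_exp (-(2 * y))
  have e1 : Real.exp (2 * y) = Real.exp y * Real.exp y := by rw [← Real.exp_add]; ring_nf
  have e2 : Real.exp (-(2 * y)) = Real.exp (-y) * Real.exp (-y) := by
    rw [← Real.exp_add]; ring_nf
  rcases abs_cases y with ⟨h, h'⟩ | ⟨h, h'⟩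
  · rw [h]
    have : (2 * y + 1) * Real.exp (-y) ≤ Real.exp y := by
      calc _ ≤ Real.exp (2 * y) * Real.exp (-y) := by gcongr
        _ = Real.exp y * (Real.exp y * Real.exp (-y)) := by rw [e1]; ring
        _ = _ := by rw [hmul, mul_one]
    linarith
  · rw [h]
    have : (-(2 * y) + 1) * Real.exp y ≤ Real.exp (-y) := by
      calc _ ≤ Real.exp (-(2 * y)) * Real.exp y := by gcongr
        _ = Real.exp (-y) * (Real.exp y * Real.exp (-y)) := by rw [e2]; ring
        _ = _ := by rw [hmul, mul_one]
    linarith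

lemma abs_two_mul_walkF_sub_one_le (y : ℝ) : |2 * walkF y - 1| ≤ 1 := by
  have hp := Real.exp_pos y
  have hn := Real.exp_pos (-y)
  have h0 : 0 ≤ walkF y := by unfold walkF; positivity
  have h1 : walkF y ≤ 1 := by
    unfold walkF
    rw [div_le_one (by positivity)]
    linarith
  rw [abs_le]
  constructor <;> linarith

lemma measurable_walkF : Measurable walkF := by
  unfold walkF
  fun_prop

section Walk

variable {Ω : Type*} {X : ℕ → Ω → ℤ}

lemma locTime_succ (n : ℕ) (e : ℤ) (ω : Ω) :
    locTime X (n + 1) e ω =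
      locTime X n e ω + if min (X n ω) (X (n + 1) ω) = e then 1 else 0 := by
  unfold locTime
  rw [Finset.range_add_one, Finset.filter_insert]
  split_ifs <;> simp

lemma locTime_le (n : ℕ) (e : ℤ) (ω : Ω) : locTime X n e ω ≤ n :=
  (Finset.card_filter_le _ _).trans_eq (Finset.card_range n)

lemma locTime_eq_sum (n : ℕ) (e : ℤ) (ω : Ω) :
    locTime X n e ω = ∑ m ∈ Finset.range n, if min (X m ω) (X (m + 1) ω) = e then 1 else 0 :=
  Finset.card_filter _ _

lemma Dab_eq_profileDrift (a b : ℝ) (n : ℕ) (ω : Ω) :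
    Dab a b X n ω = profileDrift a b (fun e => locTime X n e ω) (X n ω) := by
  simp [Dab, profileDrift, shiftedProfile, sub_eq_add_neg]

/-- The indicator of a step to the right at time `n`. -/
def rightStep (X : ℕ → Ω → ℤ) (n : ℕ) (ω : Ω) : ℝ :=
  if X (n + 1) ω = X n ω + 1 then 1 else 0

/-- The energy of the local time profile at time `n`. -/
def walkEnergy (a b : ℝ) (X : ℕ → Ω → ℤ) (N n : ℕ) (ω : Ω) : ℝ :=
  profileEnergy a b N fun e => locTime X n e ω

lemma abs_two_mul_rightStep_sub_one (n : ℕ) (ω : Ω) : |2 * rightStep X n ω - 1| = 1 := by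
  unfold rightStep
  split_ifs <;> norm_num

lemma abs_le_of_step {ω : Ω} (h0 : X 0 ω = 0) (hs : ∀ n, |X (n + 1) ω - X n ω| = 1) (n : ℕ) :
    |X n ω| ≤ n := by
  induction n with
  | zero => simp [h0]
  | succ n ih =>
    have h := hs n
    push_cast
    calc |X (n + 1) ω| = |(X (n + 1) ω - X n ω) + X n ω| := by ring_nf
      _ ≤ |X (n + 1) ω - X n ω| + |X n ω| := abs_add_le _ _
      _ ≤ n + 1 := by omega

lemma walkEnergy_succ (a b : ℝ) {ω : Ω} (h0 : X 0 ω = 0)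
    (hs : ∀ n, |X (n + 1) ω - X n ω| = 1) {N n : ℕ} (hn : n + 1 < N) :
    walkEnergy a b X N (n + 1) ω = walkEnergy a b X N n ω +
      (2 * rightStep X n ω - 1) * (Dab a b X (n + 1) ω - Dab a b X n ω) := by
  have hx := abs_le.1 (abs_le_of_step h0 hs n)
  have hℓ : (fun e => (locTime X (n + 1) e ω : ℝ)) = fun e => (locTime X n e ω : ℝ) +
      if min (X n ω) (X (n + 1) ω) = e then 1 else 0 := by
    funext e
    rw [locTime_succ]
    push_cast
    rfl
  rcases (abs_eq zero_le_one).1 (hs n) with h | h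
  · have hX : X (n + 1) ω = X n ω + 1 := by omega
    have hmin : min (X n ω) (X (n + 1) ω) = X n ω := by omega
    rw [hmin] at hℓ
    have e1 : X n ω + 1 - 2 = X n ω - 1 := by ring
    rw [Dab_eq_profileDrift, Dab_eq_profileDrift, walkEnergy, hℓ,
      profileEnergy_add_single _ _ _ _ _ (by omega) (by omega), hX]
    have n1 : X n ω ≠ X n ω - 1 := by omega
    simp [rightStep, hX, walkEnergy, profileDrift, e1, n1, add_assoc]
    ring
  · have hX : X n ω = X (n + 1) ω + 1 := by omega
    have hmin : min (X n ω) (X (n + 1) ω) = X (n + 1) ω := by omega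
    rw [hmin] at hℓ
    have hne : X (n + 1) ω ≠ X (n + 1) ω + 1 + 1 := by omega
    have e1 : X (n + 1) ω + 1 - 2 = X (n + 1) ω - 1 := by ring
    rw [Dab_eq_profileDrift, Dab_eq_profileDrift, walkEnergy, hℓ,
      profileEnergy_add_single _ _ _ _ _ (by omega) (by omega), hX]
    have n1 : X (n + 1) ω ≠ X (n + 1) ω - 1 := by omega
    have n2 : X (n + 1) ω ≠ X (n + 1) ω - 2 := by omega
    simp [rightStep, hX, hne, walkEnergy, profileDrift, e1, n1, n2]
    ring

lemma walkEnergy_zero (a b : ℝ) (N : ℕ) (ω : Ω) : walkEnergy a b X N 0 ω = 0 := by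
  simp [walkEnergy, profileEnergy, locTime]

lemma Dab_zero (a b : ℝ) (ω : Ω) : Dab a b X 0 ω = 0 := by
  simp [Dab, shiftedProfile, locTime]

lemma abs_Dab_le (a b : ℝ) (n : ℕ) (ω : Ω) : |Dab a b X n ω| ≤ 2 * (|a| + |b|) * n := by
  have h (c : ℝ) (k : ℤ) : |c * shiftedProfile X n k ω| ≤ |c| * n := by
    rw [abs_mul, Nat.abs_cast]
    gcongr
    exact locTime_le _ _ _
  have h1 := h a (-2)
  have h2 := h b (-1)
  have h3 := h b 0
  have h4 := h a 1
  unfold Dab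
  rw [abs_le] at *
  constructor <;> linarith

/-- Confinement in `[-R, R]` forces the energy at time `n` to be of order `n ^ 2`. -/
lemma sq_le_walkEnergy {a b : ℝ} (ha : a < 0) (hab : -a ≤ b / 3) {R N n : ℕ} (hR : R + 1 ≤ N)
    {ω : Ω} (hX : ∀ m, |X m ω| ≤ R) :
    -a * (n : ℝ) ^ 2 ≤ 2 * ((2 * R + 1) * (2 * R + 1) ^ 2) ^ 2 * walkEnergy a b X N n ω := by
  set ℓ : ℤ → ℝ := fun e => locTime X n e ω with hℓ
  have hE : walkEnergy a b X N n ω = profileEnergy a b N ℓ := rfl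
  have hE0 := profileEnergy_nonneg ha.le hab N ℓ
  set t := √(2 * profileEnergy a b N ℓ / -a) with ht
  have ht0 : 0 ≤ t := Real.sqrt_nonneg _
  have hna : 0 < -a := by linarith
  have ht2 : t ^ 2 = 2 * profileEnergy a b N ℓ / -a := Real.sq_sqrt (by positivity)
  have hmem (m : ℕ) : min (X m ω) (X (m + 1) ω) ∈ Finset.Icc (-(R : ℤ)) R := by
    have h1 := abs_le.1 (hX m)
    have h2 := abs_le.1 (hX (m + 1))
    rw [Finset.mem_Icc]
    omega
  have hzero (e : ℤ) (he : e < -(R : ℤ)) : ℓ e = 0 := by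
    simp only [hℓ, locTime, Nat.cast_eq_zero, Finset.card_eq_zero, Finset.filter_eq_empty_iff]
    intro m _ hm
    have := Finset.mem_Icc.1 (hmem m)
    omega
  have hsum : (n : ℝ) = ∑ e ∈ Finset.Icc (-(R : ℤ)) R, ℓ e := by
    have := Finset.card_eq_sum_card_fiberwise (s := Finset.range n)
      (f := fun m => min (X m ω) (X (m + 1) ω)) (t := Finset.Icc (-(R : ℤ)) R)
      (fun m _ => by simpa using hmem m)
    rw [Finset.card_range] at this
    simp only [hℓ, locTime]
    exact_mod_cast this
  have hle (e : ℤ) (he : e ∈ Finset.Icc (-(R : ℤ)) R) : ℓ e ≤ (2 * R + 1) ^ 2 * t := by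
    rw [Finset.mem_Icc] at he
    have h := le_of_second_diff_le (ℓ := ℓ) (c := -R - 1) (K := 2 * R + 1) ht0
      (hzero _ (by omega)) (hzero _ (by omega)) (fun k hk => by
        refine Real.le_sqrt_of_sq_le ?_
        rw [le_div_iff₀ hna, mul_comm]
        exact sq_second_diff_le_profileEnergy ha.le hab N ℓ (by rw [Finset.mem_Icc]; omega))
      (e + R + 1).toNat (by omega)
    rw [Int.toNat_of_nonneg (by omega)] at h
    convert h using 2
    · ring
    · push_cast; ring
  have hn : (n : ℝ) ≤ (2 * R + 1) * (2 * R + 1) ^ 2 * t := by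
    rw [hsum]
    refine (Finset.sum_le_card_nsmul _ _ _ hle).trans_eq ?_
    have hc : (Finset.Icc (-(R : ℤ)) R).card = 2 * R + 1 := by
      rw [Int.card_Icc]
      omega
    rw [hc, nsmul_eq_mul]
    push_cast
    ring
  calc -a * (n : ℝ) ^ 2 ≤ -a * ((2 * R + 1) * (2 * R + 1) ^ 2 * t) ^ 2 := by gcongr
    _ = ((2 * R + 1) * (2 * R + 1) ^ 2) ^ 2 * (-a * t ^ 2) := by ring
    _ = _ := by
      rw [ht2, mul_div_cancel₀ _ hna.ne', hE]
      ring

lemma measurable_walkFiltration {m n : ℕ} (h : m ≤ n) : Measurable[walkFiltration X n] (X m) :=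
  Measurable.of_comap_le <|
    le_iSup₂_of_le (f := fun m (_ : m ∈ Finset.range (n + 1)) =>
      MeasurableSpace.comap (X m) inferInstance) m (by simp; omega) le_rfl

lemma measurable_locTime_comp {m : MeasurableSpace Ω} {n : ℕ} {f : Ω → ℤ}
    (hX : ∀ k ≤ n, Measurable[m] (X k)) (hf : Measurable[m] f) :
    Measurable[m] fun ω => (locTime X n (f ω) ω : ℝ) := by
  simp only [locTime_eq_sum]
  push_cast
  refine Finset.measurable_sum _ fun k hk => ?_
  rw [Finset.mem_range] at hk
  exact Measurable.ite (measurableSet_eq_fun ((hX k (by omega)).min (hX (k + 1) (by omega))) hf)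
    measurable_const measurable_const

lemma measurable_Dab (a b : ℝ) {m : MeasurableSpace Ω} {n : ℕ}
    (hX : ∀ k ≤ n, Measurable[m] (X k)) : Measurable[m] (Dab a b X n) := by
  have h (k : ℤ) : Measurable[m] fun ω => (shiftedProfile X n k ω : ℝ) :=
    measurable_locTime_comp hX ((hX n le_rfl).add_const k)
  unfold Dab
  exact ((((h _).const_mul a).add ((h _).const_mul b)).sub ((h _).const_mul b)).sub
    ((h _).const_mul a)

lemma abs_walkEnergy_le (a b : ℝ) (N n : ℕ) (ω : Ω) :
    |walkEnergy a b X N n ω| ≤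
      (1 / 2) * ∑ _x ∈ Finset.Icc (-(N : ℤ)) N,
        (|a| * (4 * n) ^ 2 + |b + 3 * a| * (4 * n) ^ 2) := by
  unfold walkEnergy profileEnergy
  rw [abs_mul, abs_of_pos (by norm_num : (0 : ℝ) < 1 / 2)]
  gcongr
  refine (Finset.abs_sum_le_sum_abs _ _).trans (Finset.sum_le_sum fun x _ => ?_)
  refine (abs_add_le _ _).trans ?_
  rw [abs_mul, abs_mul, abs_neg, abs_sq, abs_sq]
  have h (e : ℤ) : (0 : ℝ) ≤ locTime X n e ω ∧ (locTime X n e ω : ℝ) ≤ n :=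
    ⟨by positivity, by exact_mod_cast locTime_le n e ω⟩
  have h1 := h (x + 1)
  have h2 := h x
  have h3 := h (x - 1)
  gcongr ?_ * ?_ + ?_ * ?_
  all_goals
    rw [sq_le_sq, abs_of_nonneg (by positivity : (0 : ℝ) ≤ 4 * n), abs_le]
    constructor <;> linarith

end Walk

section Measurability

variable {Ω : Type*} [mΩ : MeasurableSpace Ω] {μ : Measure Ω} {X : ℕ → Ω → ℤ}

lemma walkFiltration_le (hX : ∀ n, Measurable (X n)) (n : ℕ) : walkFiltration X n ≤ mΩ :=
  iSup₂_le fun m _ => (hX m).comap_le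

lemma measurable_walkEnergy (hX : ∀ n, Measurable (X n)) (a b : ℝ) (N n : ℕ) :
    Measurable (walkEnergy a b X N n) := by
  have h (e : ℤ) : Measurable fun ω => (locTime X n e ω : ℝ) :=
    measurable_locTime_comp (fun k _ => hX k) measurable_const
  unfold walkEnergy profileEnergy
  fun_prop

lemma measurable_rightStep (hX : ∀ n, Measurable (X n)) (n : ℕ) :
    Measurable (rightStep X n) :=
  Measurable.ite (measurableSet_eq_fun (hX (n + 1)) ((hX n).add_const 1))
    measurable_const measurable_const

variable [IsProbabilityMeasure μ]

lemma integrable_Dab (hX : ∀ n, Measurable (X n)) (a b : ℝ) (n : ℕ) :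
    Integrable (Dab a b X n) μ :=
  .of_bound (measurable_Dab a b fun k _ => hX k).aestronglyMeasurable _
    (.of_forall fun ω => abs_Dab_le a b n ω)

lemma integrable_walkEnergy (hX : ∀ n, Measurable (X n)) (a b : ℝ) (N n : ℕ) :
    Integrable (walkEnergy a b X N n) μ :=
  .of_bound (measurable_walkEnergy hX a b N n).aestronglyMeasurable _
    (.of_forall fun ω => abs_walkEnergy_le a b N n ω)

lemma integrable_rightStep (hX : ∀ n, Measurable (X n)) (n : ℕ) :
    Integrable (rightStep X n) μ :=
  .of_bound (measurable_rightStep hX n).aestronglyMeasurable 1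
    (.of_forall fun ω => by unfold rightStep; split_ifs <;> simp)

lemma integrable_step_mul_Dab (hX : ∀ n, Measurable (X n)) (a b : ℝ) (k n : ℕ) :
    Integrable (fun ω => (2 * rightStep X k ω - 1) * Dab a b X n ω) μ :=
  (integrable_Dab hX a b n).bdd_mul (c := 1)
    (((measurable_rightStep hX k).const_mul 2).sub_const 1).aestronglyMeasurable
    (.of_forall fun ω => (abs_two_mul_rightStep_sub_one k ω).le)

lemma integrable_Dab_mul_walkF (hX : ∀ n, Measurable (X n)) (a b : ℝ) (n : ℕ) :
    Integrable (fun ω => Dab a b X n ω * (2 * walkF (Dab a b X n ω) - 1)) μ :=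
  (integrable_Dab hX a b n).mul_bdd (c := 1)
    (((measurable_walkF.comp (measurable_Dab a b fun k _ => hX k)).const_mul 2).sub_const
      1).aestronglyMeasurable
    (.of_forall fun _ => abs_two_mul_walkF_sub_one_le _)

lemma integral_step_mul_Dab (hX : ∀ n, Measurable (X n)) (a b : ℝ) (n : ℕ)
    (hdrive : μ[rightStep X n | walkFiltration X n] =ᵐ[μ] fun ω => walkF (Dab a b X n ω)) :
    ∫ ω, (2 * rightStep X n ω - 1) * Dab a b X n ω ∂μ =
      ∫ ω, Dab a b X n ω * (2 * walkF (Dab a b X n ω) - 1) ∂μ := by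
  have hD := integrable_Dab (μ := μ) hX a b n
  have hRD : Integrable (rightStep X n * Dab a b X n) μ := by
    have := ((integrable_step_mul_Dab (μ := μ) hX a b n n).add hD).div_const 2
    refine this.congr (.of_forall fun ω => ?_)
    simp only [Pi.add_apply, Pi.mul_apply]
    ring
  have hFD : Integrable (fun ω => walkF (Dab a b X n ω) * Dab a b X n ω) μ := by
    have := ((integrable_Dab_mul_walkF (μ := μ) hX a b n).add hD).div_const 2
    refine this.congr (.of_forall fun ω => ?_)
    simp only [Pi.add_apply]
    ring
  have hpull : ∫ ω, (rightStep X n * Dab a b X n) ω ∂μ =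
      ∫ ω, walkF (Dab a b X n ω) * Dab a b X n ω ∂μ := by
    rw [← integral_condExp (walkFiltration_le hX n)]
    refine integral_congr_ae ?_
    have hm : StronglyMeasurable[walkFiltration X n] (Dab a b X n) :=
      (measurable_Dab a b fun k hk => measurable_walkFiltration hk).stronglyMeasurable
    filter_upwards [condExp_mul_of_stronglyMeasurable_right hm hRD (integrable_rightStep hX n),
      hdrive] with ω h1 h2
    rw [h1, Pi.mul_apply, h2]
  calc _ = ∫ ω, (2 * (rightStep X n * Dab a b X n) ω - Dab a b X n ω) ∂μ := by
        congr 1 with ω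
        simp only [Pi.mul_apply]
        ring
    _ = ∫ ω, (2 * (walkF (Dab a b X n ω) * Dab a b X n ω) - Dab a b X n ω) ∂μ := by
        rw [integral_sub (hRD.const_mul 2) hD, integral_sub (hFD.const_mul 2) hD,
          integral_const_mul, integral_const_mul, hpull]
    _ = _ := by
        congr 1 with ω
        ring

lemma integral_walkEnergy_sub_le (hX : ∀ n, Measurable (X n)) (hX0 : ∀ᵐ ω ∂μ, X 0 ω = 0)
    (hstep : ∀ n, ∀ᵐ ω ∂μ, |X (n + 1) ω - X n ω| = 1) (a b : ℝ)
    (hdrive : ∀ n, μ[rightStep X n | walkFiltration X n] =ᵐ[μ]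
      fun ω => walkF (Dab a b X n ω)) {N n : ℕ} (hn : n < N) :
    ∫ ω, (walkEnergy a b X N n ω - (2 * rightStep X n ω - 1) * Dab a b X n ω) ∂μ ≤ n := by
  induction n with
  | zero => simp [walkEnergy_zero, Dab_zero]
  | succ n ih =>
    have hE := integrable_walkEnergy (μ := μ) hX a b N
    have hS := integrable_step_mul_Dab (μ := μ) hX a b
    have hbound : ∫ ω, (2 * rightStep X n ω - 1) * Dab a b X (n + 1) ω ∂μ -
        ∫ ω, Dab a b X (n + 1) ω * (2 * walkF (Dab a b X (n + 1) ω) - 1) ∂μ ≤ 1 := by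
      rw [← integral_sub (hS _ _) (integrable_Dab_mul_walkF hX a b _)]
      calc _ ≤ ∫ _, (1 : ℝ) ∂μ :=
            integral_mono ((hS _ _).sub (integrable_Dab_mul_walkF hX a b _))
              (integrable_const _) fun ω =>
                mul_sub_mul_walkF_le _ _ (abs_two_mul_rightStep_sub_one n ω).le
        _ = 1 := by simp
    have hstepE : ∫ ω, walkEnergy a b X N (n + 1) ω ∂μ =
        ∫ ω, (walkEnergy a b X N n ω - (2 * rightStep X n ω - 1) * Dab a b X n ω) ∂μ +
          ∫ ω, (2 * rightStep X n ω - 1) * Dab a b X (n + 1) ω ∂μ := by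
      rw [← integral_add (by exact (hE n).sub (hS n n)) (hS _ _)]
      refine integral_congr_ae ?_
      filter_upwards [hX0, ae_all_iff.2 hstep] with ω h0 hs
      rw [walkEnergy_succ a b h0 hs hn]
      ring
    rw [integral_sub (hE _) (hS _ _), integral_step_mul_Dab hX a b _ (hdrive _), hstepE]
    have := ih (by omega)
    push_cast
    linarith

/-- The walk almost surely leaves every box. -/
lemma measure_confined_eq_zero (hX : ∀ n, Measurable (X n)) (hX0 : ∀ᵐ ω ∂μ, X 0 ω = 0)
    (hstep : ∀ n, ∀ᵐ ω ∂μ, |X (n + 1) ω - X n ω| = 1) {a b : ℝ} (ha : a < 0)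
    (hab : -a ≤ b / 3)
    (hdrive : ∀ n, μ[rightStep X n | walkFiltration X n] =ᵐ[μ]
      fun ω => walkF (Dab a b X n ω)) (R : ℕ) :
    μ {ω | ∀ n, |X n ω| ≤ R} = 0 := by
  set A := {ω | ∀ n, |X n ω| ≤ R} with hA
  have hAm : MeasurableSet A := by
    have : A = ⋂ n, X n ⁻¹' {x | |x| ≤ R} := by ext; simp [hA]
    rw [this]
    exact MeasurableSet.iInter fun n => hX n (MeasurableSet.of_discrete)
  set C : ℝ := 2 * ((2 * R + 1) * (2 * R + 1) ^ 2) ^ 2 with hC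
  have hC0 : 0 < C := by positivity
  set B : ℝ := 2 * (|a| + |b|) with hB
  have hmain (n : ℕ) : -a / C * (n : ℝ) ^ 2 * μ.real A ≤ (1 + B) * n := by
    have hN : n < n + R + 1 := by omega
    have h := integral_walkEnergy_sub_le hX hX0 hstep a b hdrive hN
    have hlow : ∫ ω, (A.indicator (fun _ => -a / C * (n : ℝ) ^ 2) ω - B * n) ∂μ ≤
        ∫ ω, (walkEnergy a b X (n + R + 1) n ω -
          (2 * rightStep X n ω - 1) * Dab a b X n ω) ∂μ := by
      refine integral_mono (((integrable_const _).indicator hAm).sub (integrable_const _))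
        ((integrable_walkEnergy hX a b _ n).sub (integrable_step_mul_Dab hX a b n n))
        fun ω => sub_le_sub ?_ ?_
      · by_cases hω : ω ∈ A
        · rw [indicator_of_mem hω, div_mul_eq_mul_div, div_le_iff₀ hC0, mul_comm _ C]
          exact sq_le_walkEnergy ha hab (by omega) hω
        · rw [indicator_of_notMem hω]
          exact profileEnergy_nonneg ha.le hab _ _
      · refine (le_abs_self _).trans ?_
        rw [abs_mul, abs_two_mul_rightStep_sub_one, one_mul]
        exact abs_Dab_le a b n ω
    rw [integral_sub ((integrable_const _).indicator hAm) (integrable_const _),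
      integral_indicator_const _ hAm] at hlow
    simp only [smul_eq_mul, integral_const, probReal_univ, one_mul] at hlow
    linarith
  by_contra hne
  have hpos : 0 < μ.real A := ENNReal.toReal_pos hne (measure_ne_top _ _)
  have hc : 0 < -a / C * μ.real A := mul_pos (div_pos (by linarith) hC0) hpos
  obtain ⟨n, hn⟩ := exists_nat_gt ((1 + B) / (-a / C * μ.real A))
  have hB0 : 0 ≤ B := by positivity
  have hn0 : (0 : ℝ) < n := lt_of_le_of_lt (by positivity) hn
  rw [div_lt_iff₀ hc] at hn
  have := mul_lt_mul_of_pos_right hn hn0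
  linarith [hmain n]

end Measurability

/-- if `a < 0 < b` and `-a ≤ b/3`, then almost surely the walk driven by
`D^{a,b}` does not eventually remain in any finite set. -/
theorem stmt2 {Ω : Type*} [MeasurableSpace Ω] (μ : Measure Ω) [IsProbabilityMeasure μ]
    (X : ℕ → Ω → ℤ) (hmeas : ∀ n, Measurable (X n))
    (hX0 : ∀ᵐ ω ∂μ, X 0 ω = 0)
    (hstep : ∀ n, ∀ᵐ ω ∂μ, |X (n + 1) ω - X n ω| = 1)
    (a b : ℝ) (ha : a < 0) (hb : 0 < b) (hab : -a ≤ b / 3)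
    (hdrive : ∀ n,
      μ[(fun ω => if X (n + 1) ω = X n ω + 1 then (1 : ℝ) else 0) | walkFiltration X n]
        =ᵐ[μ] fun ω => walkF (Dab a b X n ω)) :
    μ {ω | ∃ n₀ : ℕ, ∃ S : Finset ℤ, ∀ n ≥ n₀, X n ω ∈ S} = 0 := by
  have hcover : {ω | ∃ n₀ : ℕ, ∃ S : Finset ℤ, ∀ n ≥ n₀, X n ω ∈ S} ⊆
      ⋃ R : ℕ, {ω | ∀ n, |X n ω| ≤ R} := by
    rintro ω ⟨n₀, S, hS⟩
    let T := ((Finset.range n₀).image (X · ω) ∪ S).image Int.natAbs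
    refine mem_iUnion.2 ⟨T.sup id, fun n => ?_⟩
    have hmem : X n ω ∈ (Finset.range n₀).image (X · ω) ∪ S := by
      rcases lt_or_ge n n₀ with h | h
      · exact Finset.mem_union_left _ (Finset.mem_image_of_mem _ (Finset.mem_range.2 h))
      · exact Finset.mem_union_right _ (hS n h)
    have : (X n ω).natAbs ≤ T.sup id :=
      Finset.le_sup (f := id) (Finset.mem_image_of_mem Int.natAbs hmem)
    rw [Int.abs_eq_natAbs]
    exact_mod_cast this
  exact measure_mono_null hcover <| measure_iUnion_null fun R =>
    measure_confined_eq_zero hmeas hX0 hstep ha hab hdrive R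
end
end

section
/- Let a ∈ ℝ and b < 0. Then with positive probability the walk driven by D^{a,b} forever jumps back and forth along one single edge: with positive probability, X_n ∈ {0, 1} for all n ≥ 0. -/
open MeasureTheory Real Filter Set

noncomputable section

/-- The trajectory up to time `n` alternates between `0` and `1`, starting from `0`. -/
def alternatesUpTo {Ω : Type*} (X : ℕ → Ω → ℤ) (n : ℕ) : Set Ω :=
  {ω | ∀ m ≤ n, X m ω = (m : ℤ) % 2}

theorem alternatesUpTo_antitone {Ω : Type*} (X : ℕ → Ω → ℤ) : Antitone (alternatesUpTo X) :=
  fun _ _ hmn _ hω k hk => hω k (hk.trans hmn)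

theorem alternatesUpTo_succ {Ω : Type*} (X : ℕ → Ω → ℤ) (n : ℕ) :
    alternatesUpTo X (n + 1) =
      alternatesUpTo X n ∩ {ω | X (n + 1) ω = ((n + 1 : ℕ) : ℤ) % 2} := by
  ext ω
  simp only [alternatesUpTo, mem_inter_iff, mem_ofPred_eq]
  refine ⟨fun h => ⟨fun m hm => h m (by omega), h _ le_rfl⟩, fun h m hm => ?_⟩
  rcases Nat.le_succ_iff.1 hm with hm | rfl
  exacts [h.1 m hm, h.2]

theorem walkFiltration_le_s3 {Ω : Type*} [m0 : MeasurableSpace Ω] {X : ℕ → Ω → ℤ}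
    (hmeas : ∀ n, Measurable (X n)) (n : ℕ) : walkFiltration X n ≤ m0 :=
  iSup₂_le fun m _ => (hmeas m).comap_le

theorem measurableSet_alternatesUpTo {Ω : Type*} (X : ℕ → Ω → ℤ) (n : ℕ) :
    MeasurableSet[walkFiltration X n] (alternatesUpTo X n) := by
  have : alternatesUpTo X n = ⋂ m ∈ Finset.range (n + 1), X m ⁻¹' {(m : ℤ) % 2} := by
    ext ω
    simp [alternatesUpTo]
  rw [this]
  refine Finset.measurableSet_biInter _ fun m hm => ?_
  have hle : MeasurableSpace.comap (X m) inferInstance ≤ walkFiltration X n :=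
    le_iSup₂ (f := fun k (_ : k ∈ Finset.range (n + 1)) =>
      MeasurableSpace.comap (X k) inferInstance) m hm
  exact hle _ ⟨_, measurableSet_singleton _, rfl⟩

theorem locTime_of_alternates {Ω : Type*} {X : ℕ → Ω → ℤ} {n : ℕ} {ω : Ω}
    (h : ω ∈ alternatesUpTo X n) (e : ℤ) : locTime X n e ω = if e = 0 then n else 0 := by
  have hmin : ∀ m ∈ Finset.range n, min (X m ω) (X (m + 1) ω) = 0 := by
    intro m hm
    have hm := Finset.mem_range.1 hm
    rw [h m hm.le, h (m + 1) hm]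
    omega
  unfold locTime
  split_ifs with he
  · rw [Finset.filter_true_of_mem (by simpa [he] using hmin), Finset.card_range]
  · rw [Finset.filter_false_of_mem, Finset.card_empty]
    intro m hm
    rw [hmin m hm]
    exact Ne.symm he

theorem Dab_of_alternates {Ω : Type*} (a b : ℝ) {X : ℕ → Ω → ℤ} {n : ℕ} {ω : Ω}
    (h : ω ∈ alternatesUpTo X n) : Dab a b X n ω = if Even n then -(b * n) else b * n := by
  unfold Dab shiftedProfile
  simp only [locTime_of_alternates h, h n le_rfl]
  split_ifs <;> first | (exfalso; grind) | simp

theorem one_sub_walkF (y : ℝ) : 1 - walkF y = walkF (-y) := by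
  unfold walkF
  have := Real.exp_pos y
  have := Real.exp_pos (-y)
  rw [neg_neg]
  field_simp
  ring

theorem exp_neg_exp_le_walkF (y : ℝ) : Real.exp (-Real.exp (-(2 * y))) ≤ walkF y := by
  have hy : walkF y = (1 + Real.exp (-(2 * y)))⁻¹ := by
    have h : Real.exp (-y) = Real.exp y * Real.exp (-(2 * y)) := by
      rw [← Real.exp_add]; ring_nf
    have := Real.exp_pos y
    have := Real.exp_pos (-(2 * y))
    unfold walkF
    rw [h]
    field_simp
  rw [hy, Real.exp_neg]
  have := Real.add_one_le_exp (Real.exp (-(2 * y)))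
  gcongr
  linarith

theorem measureReal_alternatesUpTo_succ {Ω : Type*} [MeasurableSpace Ω] {μ : Measure Ω}
    [IsProbabilityMeasure μ] {X : ℕ → Ω → ℤ} (hmeas : ∀ n, Measurable (X n)) {a b : ℝ} {n : ℕ}
    (hstep : ∀ᵐ ω ∂μ, |X (n + 1) ω - X n ω| = 1)
    (hdrive : μ[(fun ω => if X (n + 1) ω = X n ω + 1 then (1 : ℝ) else 0) | walkFiltration X n]
        =ᵐ[μ] fun ω => walkF (Dab a b X n ω)) :
    μ.real (alternatesUpTo X (n + 1)) = walkF (-(b * n)) * μ.real (alternatesUpTo X n) := by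
  set A := alternatesUpTo X n
  set R : Set Ω := {ω | X (n + 1) ω = X n ω + 1} with hR
  have hle := walkFiltration_le_s3 hmeas n
  have hAm : MeasurableSet A := hle _ (measurableSet_alternatesUpTo X n)
  have hRm : MeasurableSet R := measurableSet_eq_fun (hmeas _) ((hmeas n).add_const 1)
  have hind : (fun ω => if X (n + 1) ω = X n ω + 1 then (1 : ℝ) else 0) =
      R.indicator fun _ => 1 := by
    ext ω
    simp [hR, indicator_apply]
  have hright : μ.real (A ∩ R) =
      walkF (if Even n then -(b * n) else b * n) * μ.real A := by
    have hset := setIntegral_condExp (μ := μ) hle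
      ((integrable_const (1 : ℝ)).indicator hRm) (measurableSet_alternatesUpTo X n)
    rw [hind] at hdrive
    rw [setIntegral_congr_ae (g := fun _ => walkF (if Even n then -(b * n) else b * n)) hAm
      (hdrive.mono fun ω h hω => h.trans (congrArg walkF (Dab_of_alternates a b hω))),
      setIntegral_indicator hRm] at hset
    simpa [mul_comm] using hset.symm
  rcases Nat.even_or_odd n with hn | hn
  · have heq : alternatesUpTo X (n + 1) = A ∩ R := by
      rw [alternatesUpTo_succ]
      ext ω
      simp only [mem_inter_iff, mem_ofPred_eq, hR]
      refine and_congr_right fun hω => ?_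
      rw [hω n le_rfl]
      grind
    rw [heq, hright, if_pos hn]
  · have heq : alternatesUpTo X (n + 1) =ᵐ[μ] (A \ R : Set Ω) := by
      filter_upwards [hstep] with ω hω
      apply propext
      change ω ∈ alternatesUpTo X (n + 1) ↔ ω ∈ A \ R
      rw [alternatesUpTo_succ]
      simp only [mem_inter_iff, Set.mem_sdiff, mem_ofPred_eq, hR]
      refine and_congr_right fun hωA => ?_
      rw [hωA n le_rfl] at hω ⊢
      grind
    have hsum := measureReal_inter_add_sdiff (μ := μ) (s := A) hRm
    rw [measureReal_congr heq, ← one_sub_walkF, sub_mul, one_mul]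
    rw [hright, if_neg (Nat.not_even_iff_odd.2 hn)] at hsum
    linarith

theorem exp_neg_sum_le_measureReal_alternatesUpTo {Ω : Type*} [MeasurableSpace Ω]
    {μ : Measure Ω} [IsProbabilityMeasure μ] {X : ℕ → Ω → ℤ} (hmeas : ∀ n, Measurable (X n))
    (hX0 : ∀ᵐ ω ∂μ, X 0 ω = 0) (hstep : ∀ n, ∀ᵐ ω ∂μ, |X (n + 1) ω - X n ω| = 1) {a b : ℝ}
    (hdrive : ∀ n,
      μ[(fun ω => if X (n + 1) ω = X n ω + 1 then (1 : ℝ) else 0) | walkFiltration X n]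
        =ᵐ[μ] fun ω => walkF (Dab a b X n ω)) (n : ℕ) :
    Real.exp (-∑ i ∈ Finset.range n, Real.exp (2 * b) ^ i) ≤
      μ.real (alternatesUpTo X n) := by
  induction n with
  | zero =>
    have : alternatesUpTo X 0 =ᵐ[μ] (univ : Set Ω) :=
      eventuallyEq_univ.2 (hX0.mono fun ω h => by simpa [alternatesUpTo] using h)
    simp [measureReal_congr this]
  | succ n ih =>
    rw [measureReal_alternatesUpTo_succ hmeas (hstep n) (hdrive n), Finset.sum_range_succ,
      neg_add_rev, Real.exp_add]
    have hF : Real.exp (-Real.exp (2 * b) ^ n) ≤ walkF (-(b * n)) := by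
      convert exp_neg_exp_le_walkF (-(b * n)) using 3
      rw [← Real.exp_nat_mul]
      ring_nf
    exact mul_le_mul hF ih (Real.exp_pos _).le ((Real.exp_pos _).le.trans hF)

/-- if `b < 0`, then with positive probability the walk driven by `D^{a,b}`
forever jumps back and forth along the single edge `{0, 1}`. -/
theorem stmt3 {Ω : Type*} [MeasurableSpace Ω] (μ : Measure Ω) [IsProbabilityMeasure μ]
    (X : ℕ → Ω → ℤ) (hmeas : ∀ n, Measurable (X n))
    (hX0 : ∀ᵐ ω ∂μ, X 0 ω = 0)
    (hstep : ∀ n, ∀ᵐ ω ∂μ, |X (n + 1) ω - X n ω| = 1)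
    (a b : ℝ) (hb : b < 0)
    (hdrive : ∀ n,
      μ[(fun ω => if X (n + 1) ω = X n ω + 1 then (1 : ℝ) else 0) | walkFiltration X n]
        =ᵐ[μ] fun ω => walkF (Dab a b X n ω)) :
    0 < μ {ω | ∀ n : ℕ, X n ω = 0 ∨ X n ω = 1} := by
  set r := Real.exp (2 * b) with hr
  have hr0 : 0 ≤ r := (Real.exp_pos _).le
  have hr1 : r < 1 := (Real.exp_lt_exp.2 (by linarith : 2 * b < 0)).trans_eq Real.exp_zero
  have hlower : ∀ n, ENNReal.ofReal (Real.exp (-(1 - r)⁻¹)) ≤ μ (alternatesUpTo X n) := by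
    intro n
    rw [ENNReal.ofReal_le_iff_le_toReal (measure_ne_top _ _)]
    refine le_trans (Real.exp_le_exp.2 (neg_le_neg ?_))
      (exp_neg_sum_le_measureReal_alternatesUpTo hmeas hX0 hstep hdrive n)
    rw [← tsum_geometric_of_lt_one hr0 hr1]
    exact (summable_geometric_of_lt_one hr0 hr1).sum_le_tsum _ fun i _ => pow_nonneg hr0 i
  have hinter : ENNReal.ofReal (Real.exp (-(1 - r)⁻¹)) ≤ μ (⋂ n, alternatesUpTo X n) := by
    rw [(alternatesUpTo_antitone X).measure_iInter
      (fun n => (walkFiltration_le_s3 hmeas n _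
        (measurableSet_alternatesUpTo X n)).nullMeasurableSet) ⟨0, measure_ne_top _ _⟩]
    exact le_iInf hlower
  refine (ENNReal.ofReal_pos.2 (Real.exp_pos _)).trans_le (hinter.trans (measure_mono ?_))
  intro ω hω n
  have := mem_iInter.1 hω n n le_rfl
  omega
end
end
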